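/- arXiv:1109.5789 — 9 statements merged into one kernel-verified Lean document; each statement's English description precedes it below -/
import Mathlib

section
/- For every ternary signature f : {0,1}³ → ℂ, the signature Sym(f) is symmetric: for all x₁,y₁,z₁ ∈ {0,1} and every permutation τ of the three arguments, Sym(f)(x₁,y₁,z₁) equals Sym(f) evaluated at the τ-permuted arguments; equivalently, the value of Sym(f) depends only on the Hamming weight of its input. -/
open Finset

/-- The symmetrization `SymSig(f)` of a ternary signature `f`. -/
noncomputable def SymSig (f : Bool → Bool → Bool → ℂ) (p q r : Bool) : ℂ :=
  ∑ p₂ : Bool, ∑ q₂ : Bool, ∑ r₂ : Bool, f p p₂ r₂ * f q q₂ p₂ * f r r₂ q₂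

/-- Hamming weight of a triple of Booleans. -/
def wt (p q r : Bool) : ℕ := (cond p 1 0) + (cond q 1 0) + (cond r 1 0)

/-- The parametrized symmetrization `SymLSig(f)_ε`, using the unary signature `u = [1, ε]`. -/
noncomputable def SymLSig (f : Bool → Bool → Bool → ℂ) (ε : ℂ) (p q : Bool) : ℂ :=
  ∑ p₁ : Bool, ∑ p₃ : Bool, ∑ q₁ : Bool,
    f p₁ p p₃ * f q₁ q p₃ * (cond p₁ ε 1) * (cond q₁ ε 1)

/-- The signature `f_σ` obtained from `f` by permuting the three arguments by `σ`. -/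
def permSig (f : Bool → Bool → Bool → ℂ) (σ : Equiv.Perm (Fin 3)) (p q r : Bool) : ℂ :=
  f (![p, q, r] (σ 0)) (![p, q, r] (σ 1)) (![p, q, r] (σ 2))

/-- Membership in the set `DUP` of ternary signatures. -/
def InDUP (f : Bool → Bool → Bool → ℂ) : Prop :=
  ∃ (σ : Equiv.Perm (Fin 3)) (u : Bool → ℂ) (f₀ : Bool → Bool → ℂ),
    ∀ p q r : Bool, permSig f σ p q r = u p * f₀ q r

/-- A ternary signature `f` is `SIG₁`-legal if `SymSig(f) = [a, b, -a, -b]` with `a² + b² ≠ 0`. -/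
def SIG1Legal (f : Bool → Bool → Bool → ℂ) : Prop :=
  ∃ a b : ℂ, a ^ 2 + b ^ 2 ≠ 0 ∧
    ∀ p q r : Bool, SymSig f p q r =
      if wt p q r = 0 then a else if wt p q r = 1 then b
      else if wt p q r = 2 then -a else -b

/-- For every ternary signature `f`, `SymSig(f)` is symmetric: invariant under every
permutation of its three arguments; equivalently, its value depends only on the
Hamming weight of the input. -/
theorem sym_is_symmetric (f : Bool → Bool → Bool → ℂ) :
    (∀ (p q r : Bool) (σ : Equiv.Perm (Fin 3)),
      SymSig f (![p, q, r] (σ 0)) (![p, q, r] (σ 1)) (![p, q, r] (σ 2)) = SymSig f p q r) ∧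
    (∀ p q r p' q' r' : Bool, wt p q r = wt p' q' r' → SymSig f p q r = SymSig f p' q' r') := by
  have h2 : ∀ p q r p' q' r' : Bool, wt p q r = wt p' q' r' →
      SymSig f p q r = SymSig f p' q' r' := by
    intro p q r p' q' r' h
    cases p <;> cases q <;> cases r <;> cases p' <;> cases q' <;> cases r' <;>
      first
      | with_reducible rfl
      | exact absurd h (by decide)
      | (simp only [SymSig, Fintype.sum_bool]; ring)
  refine ⟨fun p q r σ => h2 _ _ _ _ _ _ ?_, h2⟩
  clear h2
  revert p q r σ
  decide
end

section
/- If f is the symmetric ternary signature [a,b,−a,−b] for some a,b ∈ ℂ (i.e., f takes values a, b, −a, −b on inputs of Hamming weight 0, 1, 2, 3 respectively), then Sym(f) is the identically zero signature [0,0,0,0]; in particular, Sym(f) is degenerate. -/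
open Finset

/-- If `f` is the symmetric ternary signature `[a, b, -a, -b]`, then `SymSig(f)` is
identically zero (hence degenerate). -/
theorem sym_of_sig1_form_is_zero (f : Bool → Bool → Bool → ℂ) (a b : ℂ)
    (hf : ∀ p q r : Bool, f p q r =
      if wt p q r = 0 then a else if wt p q r = 1 then b
      else if wt p q r = 2 then -a else -b) :
    ∀ p q r : Bool, SymSig f p q r = 0 := by
  intro p q r
  cases p <;> cases q <;> cases r <;> simp [SymSig, hf, wt] <;> ring
end

section
/- Let f = [a,b,c,d] be a symmetric ternary signature belonging to Sig^(2) with binding coefficients (α,β). If either αβ = 0, or αβ ≠ 0, b ≠ 0, and (β/α + a/b)² = −1, then Sym(f) belongs to Sig^(2). -/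
open Finset

/-- If `f = [a,b,c,d]` belongs to `Sig⁽²⁾` with binding coefficients `(α, β)` and either
`αβ = 0`, or `αβ ≠ 0`, `b ≠ 0` and `(β/α + a/b)² = -1`, then `SymSig(f)` belongs to `Sig⁽²⁾`. -/
theorem sym_of_sig2 (f : Bool → Bool → Bool → ℂ) (a b c d α β : ℂ)
    (hf : ∀ p q r : Bool, f p q r =
      if wt p q r = 0 then a else if wt p q r = 1 then b
      else if wt p q r = 2 then c else d)
    (hαβ : ¬(α = 0 ∧ β = 0))
    (hbind1 : α * a + β * b - α * c = 0)
    (hbind2 : α * b + β * c - α * d = 0)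
    (hcond : α * β = 0 ∨ (α * β ≠ 0 ∧ b ≠ 0 ∧ (β / α + a / b) ^ 2 = -1)) :
    ∃ α' β' : ℂ, ¬(α' = 0 ∧ β' = 0) ∧
      α' * SymSig f false false false + β' * SymSig f true false false
        - α' * SymSig f true true false = 0 ∧
      α' * SymSig f true false false + β' * SymSig f true true false
        - α' * SymSig f true true true = 0 := by
  have h0 : SymSig f false false false = a^3+3*a*b^2+3*b^2*c+c^3 := by
    simp [SymSig, hf, wt]; ring
  have h1 : SymSig f true false false = b*(a^2+b^2)+2*c*b*(a+c)+d*(b^2+c^2) := by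
    simp [SymSig, hf, wt]; ring
  have h2 : SymSig f true true false = a*(b^2+c^2)+2*b*c*(b+d)+c*(c^2+d^2) := by
    simp [SymSig, hf, wt]; ring
  have h3 : SymSig f true true true = b^3+3*b*c^2+3*c^2*d+d^3 := by
    simp [SymSig, hf, wt]; ring
  rw [h0, h1, h2, h3]
  clear h0 h1 h2 h3 hf
  rcases hcond with h | ⟨h, hb, hs⟩
  · rcases mul_eq_zero.1 h with h | h
    · subst h
      have hβ : β ≠ 0 := fun h => hαβ ⟨rfl, h⟩
      have hb : b = 0 := by simpa [hβ] using hbind1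
      have hc : c = 0 := by simpa [hβ] using hbind2
      subst hb hc
      exact ⟨0, 1, by simp, by simp, by simp⟩
    · subst h
      have hα : α ≠ 0 := fun h => hαβ ⟨h, rfl⟩
      have hc : c = a := by
        apply mul_left_cancel₀ hα; linear_combination -hbind1
      have hd : d = b := by
        apply mul_left_cancel₀ hα; linear_combination -hbind2
      subst hc hd
      exact ⟨1, 0, by simp, by ring, by ring⟩
  · have hα : α ≠ 0 := left_ne_zero_of_mul h
    obtain ⟨t, rfl⟩ : ∃ t, β = α * t := ⟨β / α, by field_simp⟩
    obtain ⟨u, rfl⟩ : ∃ u, a = u * b := ⟨a / b, by field_simp⟩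
    have hs' : (t + u) ^ 2 = -1 := by
      rw [← hs]; field_simp
    obtain ⟨s, hsd⟩ : ∃ s, s = t + u := ⟨_, rfl⟩
    rw [← hsd] at hs'
    obtain rfl : t = s - u := by rw [hsd]; ring
    have hc : c = s * b := by
      apply mul_left_cancel₀ hα; linear_combination -hbind1
    have hd : d = - (s * u) * b := by
      apply mul_left_cancel₀ hα
      subst hc
      linear_combination -hbind2 + α * b * hs'
    clear hbind1 hbind2 hs h hαβ hsd
    subst hc hd
    obtain ⟨S1, hS1⟩ : ∃ x, x = b*((u*b)^2+b^2)+2*(s*b)*b*(u*b+s*b)+(-(s*u)*b)*(b^2+(s*b)^2) := ⟨_, rfl⟩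
    have e2 : u*b*(b^2+(s*b)^2)+2*b*(s*b)*(b+(-(s*u)*b))+(s*b)*((s*b)^2+(-(s*u)*b)^2) = -s * S1 := by
      subst hS1; grind
    have e3 : b^3+3*b*(s*b)^2+3*(s*b)^2*(-(s*u)*b)+(-(s*u)*b)^3 =
        s * ((u*b)^3+3*(u*b)*b^2+3*b^2*(s*b)+(s*b)^3) := by
      grind
    rw [e2, e3, ← hS1]
    by_cases hz : S1 = 0
    · exact ⟨0, 1, by simp, by simp [hz], by simp [hz]⟩
    · refine ⟨S1, -s * S1 - ((u*b)^3+3*(u*b)*b^2+3*b^2*(s*b)+(s*b)^3), fun h => hz h.1, by ring, ?_⟩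
      linear_combination S1 ^ 2 * hs'
end

section
/- Let f be a ternary signature with f ∉ DUP. Then for every permutation σ of {1,2,3}, the binary signature SymL(f_σ)_ε = [g₀,ε, g₁,ε, g₂,ε] is non-degenerate (i.e., g₀,ε·g₂,ε ≠ (g₁,ε)²) for all but finitely many values ε ∈ ℂ; equivalently, the set {ε ∈ ℂ : g₀,ε·g₂,ε = (g₁,ε)²} is finite. -/
open Finset

lemma rank_one_aux (X Y : Bool → Bool → ℂ)
    (h : ∀ p q r s, X p q * Y r s = X r s * Y p q) :
    ∃ (u : Bool → ℂ) (k : Bool → Bool → ℂ),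
      ∀ p q, X p q = u false * k p q ∧ Y p q = u true * k p q := by
  by_cases hX : ∃ p q, X p q ≠ 0
  · obtain ⟨p, q, hpq⟩ := hX
    refine ⟨fun b => cond b (Y p q / X p q) 1, X, fun r s => ⟨by simp, ?_⟩⟩
    have := h p q r s
    simp only [cond_true]
    field_simp
    linear_combination this
  · push Not at hX
    exact ⟨fun b => cond b 1 0, Y, fun r s => ⟨by simp [hX], by simp⟩⟩

lemma minors_aux (a b c d e f g h : ℂ) (h1 : a * d = b * c) (h2 : e * h = f * g)
    (h3 : a * h + e * d = b * g + f * c) :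
    (a * g = c * e ∧ a * h = c * f ∧ b * g = d * e ∧ b * h = d * f) ∨
    (a * f = b * e ∧ a * h = b * g ∧ c * f = d * e ∧ c * h = d * g) := by
  by_contra hn
  rw [not_or] at hn
  obtain ⟨hn1, hn2⟩ := hn
  have key : ∀ x y : ℂ, x * y = 0 → x = 0 ∨ y = 0 := fun x y => mul_eq_zero.mp
  have k1 := key (a*g-c*e) (a*f-b*e) (by grind)
  have k2 := key (a*g-c*e) (a*h-b*g) (by grind)
  have k3 := key (a*g-c*e) (c*h-d*g) (by grind)
  have l1 := key (b*h-d*f) (a*f-b*e) (by grind)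
  have l2 := key (b*h-d*f) (a*h-b*g) (by grind)
  have l3 := key (b*h-d*f) (c*h-d*g) (by grind)
  have m1 := key (a*h-c*f) (a*f-b*e) (by grind)
  have m2 := key (a*h-c*f) (a*h-b*g) (by grind)
  have m3 := key (a*h-c*f) (c*h-d*g) (by grind)
  grind

lemma degenerate_aux (g : Bool → Bool → Bool → ℂ)
    (h : ¬ {ε : ℂ | SymLSig g ε false false * SymLSig g ε true true
        = (SymLSig g ε false true) ^ 2}.Finite) :
    (∃ (u : Bool → ℂ) (k : Bool → Bool → ℂ), ∀ p q r, g p q r = u q * k p r) ∨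
    (∃ (u : Bool → ℂ) (k : Bool → Bool → ℂ), ∀ p q r, g p q r = u r * k p q) := by
  classical
  let c0 := g false false false * g false true true - g false false true * g false true false
  let c2 := g true false false * g true true true - g true false true * g true true false
  let c1 := g false false false * g true true true + g true false false * g false true true
    - g false false true * g true true false - g true false true * g false true false
  let P : Polynomial ℂ := Polynomial.C c0 + Polynomial.C c1 * Polynomial.X
    + Polynomial.C c2 * Polynomial.X ^ 2
  have hP : P = 0 := by
    by_contra hP
    apply h
    refine (P.roots.toFinset.finite_toSet).subset ?_
    intro ε hε
    simp only [Set.mem_setOf_eq, SymLSig, Fintype.sum_bool, cond_true, cond_false] at hε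
    simp only [Finset.mem_coe, Multiset.mem_toFinset, Polynomial.mem_roots hP,
      Polynomial.IsRoot.def]
    simp only [P, Polynomial.eval_add, Polynomial.eval_mul, Polynomial.eval_C,
      Polynomial.eval_X, Polynomial.eval_pow, c0, c1, c2]
    rw [← sq_eq_zero_iff]
    linear_combination hε
  have e0 : c0 = 0 := by
    have := congrArg (fun p => Polynomial.coeff p 0) hP
    simpa [P] using this
  have e1 : c1 = 0 := by
    have := congrArg (fun p => Polynomial.coeff p 1) hP
    simpa [P, Polynomial.coeff_X_pow, Polynomial.coeff_C] using this
  have e2 : c2 = 0 := by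
    have := congrArg (fun p => Polynomial.coeff p 2) hP
    simpa [P, Polynomial.coeff_X, Polynomial.coeff_C] using this
  simp only [c0, c1, c2] at e0 e1 e2
  rcases minors_aux (g false false false) (g false false true) (g false true false)
    (g false true true) (g true false false) (g true false true) (g true true false)
    (g true true true) (by linear_combination e0) (by linear_combination e2)
    (by linear_combination e1) with hm | hm
  · left
    obtain ⟨u, k, hk⟩ := rank_one_aux (fun p r => g p false r) (fun p r => g p true r) (by
      rintro (_ | _) (_ | _) (_ | _) (_ | _) <;> grind)
    refine ⟨u, k, fun p q r => ?_⟩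
    cases q
    · exact (hk p r).1
    · exact (hk p r).2
  · right
    obtain ⟨u, k, hk⟩ := rank_one_aux (fun p q => g p q false) (fun p q => g p q true) (by
      rintro (_ | _) (_ | _) (_ | _) (_ | _) <;> grind)
    refine ⟨u, k, fun p q r => ?_⟩
    cases r
    · exact (hk p q).1
    · exact (hk p q).2

/-- If `f ∉ DUP`, then for every permutation `σ`, `SymLSig(f_σ)_ε` is non-degenerate for all
but finitely many `ε ∈ ℂ`: the set of `ε` with `g₀·g₂ = g₁²` is finite. -/
theorem symL_nondegenerate (f : Bool → Bool → Bool → ℂ) (hdup : ¬ InDUP f) :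
    ∀ σ : Equiv.Perm (Fin 3),
      {ε : ℂ | SymLSig (permSig f σ) ε false false * SymLSig (permSig f σ) ε true true
        = (SymLSig (permSig f σ) ε false true) ^ 2}.Finite := by
  intro σ
  by_contra hfin
  apply hdup
  rcases degenerate_aux _ hfin with ⟨u, k, hk⟩ | ⟨u, k, hk⟩
  · refine ⟨Equiv.swap 0 1 * σ, u, k, fun p q r => ?_⟩
    rw [← hk q p r]
    have key : ∀ i : Fin 3, ![p, q, r] (Equiv.swap 0 1 i) = ![q, p, r] i := by
      intro i; fin_cases i <;> rfl
    simp only [permSig, Equiv.Perm.mul_apply, key]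
  · refine ⟨Equiv.swap 0 2 * σ, u, fun q r => k r q, fun p q r => ?_⟩
    rw [← hk r q p]
    have key : ∀ i : Fin 3, ![p, q, r] (Equiv.swap 0 2 i) = ![r, q, p] i := by
      intro i; fin_cases i <;> rfl
    simp only [permSig, Equiv.Perm.mul_apply, key]
end

section
/- Let f be a ternary signature that is SIG₁-legal and satisfies f ∉ DUP. Suppose that for every permutation σ of {1,2,3} and for all but finitely many ε ∈ ℂ, writing SymL(f_σ)_ε = [g₀,ε^σ, g₁,ε^σ, g₂,ε^σ], either g₀,ε^σ + g₂,ε^σ = 0 or (g₀,ε^σ = g₂,ε^σ and g₁,ε^σ = 0) holds. Then there do not exist two distinct permutations σ and τ of {1,2,3} such that (g₀,ε^σ = g₂,ε^σ and g₁,ε^σ = 0) holds for all but finitely many ε ∈ ℂ and g₀,ε^τ + g₂,ε^τ = 0 holds for all but finitely many ε ∈ ℂ. -/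
open Finset

/-- Hat basis vectors: false is (1, i), true is (1, -i). -/
noncomputable def zz (s a : Bool) : ℂ := cond a (cond s (-Complex.I) Complex.I) 1

noncomputable def hat2 (A : Bool → Bool → ℂ) (j k : Bool) : ℂ :=
  ∑ b : Bool, ∑ c : Bool, zz j b * zz k c * A b c

noncomputable def HH (f : Bool → Bool → Bool → ℂ) (i j k : Bool) : ℂ :=
  ∑ a : Bool, zz i a * hat2 (f a) j k

lemma quad_zero (c0 c1 c2 : ℂ) (S : Set ℂ) (hS : S.Finite)
    (h : ∀ e, e ∉ S → c0 + c1 * e + c2 * e ^ 2 = 0) : c0 = 0 ∧ c1 = 0 ∧ c2 = 0 := by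
  have key : ∀ T : Set ℂ, T.Finite → ∃ e, e ∉ T := fun T hT => hT.exists_notMem
  obtain ⟨x, hx⟩ := key S hS
  obtain ⟨y, hy⟩ := key (S ∪ {x}) (hS.union (Set.finite_singleton _))
  obtain ⟨w, hw⟩ := key (S ∪ {x} ∪ {y})
    ((hS.union (Set.finite_singleton _)).union (Set.finite_singleton _))
  simp only [Set.mem_union, Set.mem_singleton_iff, not_or] at hy hw
  have h1 := h x hx
  have h2 := h y hy.1
  have h3 := h w hw.1.1
  have hyx : y - x ≠ 0 := sub_ne_zero.2 hy.2
  have hwx : w - x ≠ 0 := sub_ne_zero.2 hw.1.2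
  have hwy : w - y ≠ 0 := sub_ne_zero.2 hw.2
  have e1 : c1 + c2 * (x + y) = 0 := by
    apply mul_left_cancel₀ hyx; linear_combination h2 - h1
  have e2 : c1 + c2 * (x + w) = 0 := by
    apply mul_left_cancel₀ hwx; linear_combination h3 - h1
  have e3 : c2 = 0 := by
    apply mul_left_cancel₀ hwy; linear_combination e2 - e1
  have e4 : c1 = 0 := by linear_combination e1 - (x + y) * e3
  refine ⟨?_, e4, e3⟩
  linear_combination h1 - x * e4 - x ^ 2 * e3

lemma lin_prod (p q r s : ℂ) (S : Set ℂ) (hS : S.Finite)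
    (h : ∀ e, e ∉ S → (p + e * q) * (r + e * s) = 0) : (p = 0 ∧ q = 0) ∨ (r = 0 ∧ s = 0) := by
  obtain ⟨h0, h1, h2⟩ := quad_zero (p * r) (p * s + q * r) (q * s) S hS
    (fun e he => by linear_combination h e he)
  grind

lemma I2 : Complex.I * Complex.I = -1 := Complex.I_mul_I

/-- The even condition in the hat basis. -/
lemma symL_E (g : Bool → Bool → Bool → ℂ) (e : ℂ)
    (h : SymLSig g e false false = SymLSig g e true true ∧ SymLSig g e false true = 0) (j : Bool) :
    (hat2 (g false) j false + e * hat2 (g true) j false) *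
    (hat2 (g false) j true + e * hat2 (g true) j true) = 0 := by
  obtain ⟨h1, h2⟩ := h
  have hI : Complex.I ^ 2 = -1 := Complex.I_sq
  have : (hat2 (g false) j false + e * hat2 (g true) j false) *
    (hat2 (g false) j true + e * hat2 (g true) j true) =
     SymLSig g e false false - SymLSig g e true true
      + 2 * zz j true * SymLSig g e false true := by
    have h3 : Complex.I ^ 3 = -Complex.I := by rw [pow_succ, hI]; ring
    have h4 : Complex.I ^ 4 = 1 := Complex.I_pow_four
    cases j <;> simp only [hat2, zz, SymLSig, Fintype.sum_bool, cond_true, cond_false] <;>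
      ring_nf <;> simp only [hI, h3, h4] <;> ring
  rw [this, h1, h2]; ring

lemma symL_T (g : Bool → Bool → Bool → ℂ) (e : ℂ)
    (h : SymLSig g e false false + SymLSig g e true true = 0) :
    (hat2 (g false) false false + e * hat2 (g true) false false) *
    (hat2 (g false) true true + e * hat2 (g true) true true) +
    (hat2 (g false) false true + e * hat2 (g true) false true) *
    (hat2 (g false) true false + e * hat2 (g true) true false) = 0 := by
  have hI : Complex.I ^ 2 = -1 := Complex.I_sq
  have : (hat2 (g false) false false + e * hat2 (g true) false false) *
    (hat2 (g false) true true + e * hat2 (g true) true true) +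
    (hat2 (g false) false true + e * hat2 (g true) false true) *
    (hat2 (g false) true false + e * hat2 (g true) true false) =
     2 * (SymLSig g e false false + SymLSig g e true true) := by
    have h3 : Complex.I ^ 3 = -Complex.I := by rw [pow_succ, hI]; ring
    have h4 : Complex.I ^ 4 = 1 := Complex.I_pow_four
    simp only [hat2, zz, SymLSig, Fintype.sum_bool, cond_true, cond_false]
    ring_nf
    simp only [hI, h3, h4]
    ring
  rw [this, h]; ring

lemma HH_eq (g : Bool → Bool → Bool → ℂ) (i j k : Bool) :
    HH g i j k = hat2 (g false) j k + zz i true * hat2 (g true) j k := by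
  simp [HH, zz]; ring

lemma E_hat (g : Bool → Bool → Bool → ℂ)
    (h : {ε : ℂ | ¬ (SymLSig g ε false false = SymLSig g ε true true ∧
        SymLSig g ε false true = 0)}.Finite) (j : Bool) :
    (∀ i, HH g i j false = 0) ∨ (∀ i, HH g i j true = 0) := by
  rcases lin_prod _ _ _ _ _ h (fun e he => symL_E g e (by simpa using he) j) with ⟨a, b⟩ | ⟨a, b⟩
  · left; intro i; rw [HH_eq, a, b]; ring
  · right; intro i; rw [HH_eq, a, b]; ring

lemma T_hat (g : Bool → Bool → Bool → ℂ)
    (h : {ε : ℂ | SymLSig g ε false false + SymLSig g ε true true ≠ 0}.Finite) :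
    (∀ i, HH g i false false * HH g i true true + HH g i false true * HH g i true false = 0) ∧
    (HH g false false false * HH g true true true + HH g false false true * HH g true true false
     + HH g true false false * HH g false true true
       + HH g true false true * HH g false true false = 0) := by
  obtain ⟨h0, h1, h2⟩ := quad_zero
    (hat2 (g false) false false * hat2 (g false) true true +
      hat2 (g false) false true * hat2 (g false) true false)
    (hat2 (g false) false false * hat2 (g true) true true +
      hat2 (g false) false true * hat2 (g true) true false +
      hat2 (g true) false false * hat2 (g false) true true +
      hat2 (g true) false true * hat2 (g false) true false)
    (hat2 (g true) false false * hat2 (g true) true true +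
      hat2 (g true) false true * hat2 (g true) true false) _ h
    (fun e he => by linear_combination symL_T g e (by simpa using he))
  constructor
  · intro i; simp only [HH_eq]
    linear_combination h0 + zz i true * h1 + (zz i true) ^ 2 * h2
  · simp only [HH_eq]
    simp only [zz, cond_true, cond_false]
    linear_combination 2 * h0 - 2 * Complex.I ^ 2 * h2

lemma perm_cases (f : Bool → Bool → Bool → ℂ) (σ : Equiv.Perm (Fin 3)) :
    permSig f σ = (fun p q r => f p q r) ∨ permSig f σ = (fun p q r => f p r q) ∨
    permSig f σ = (fun p q r => f q p r) ∨ permSig f σ = (fun p q r => f r p q) ∨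
    permSig f σ = (fun p q r => f q r p) ∨ permSig f σ = (fun p q r => f r q p) := by
  have : ∀ σ : Equiv.Perm (Fin 3), (σ 0 = 0 ∧ σ 1 = 1 ∧ σ 2 = 2) ∨ (σ 0 = 0 ∧ σ 1 = 2 ∧ σ 2 = 1) ∨
    (σ 0 = 1 ∧ σ 1 = 0 ∧ σ 2 = 2) ∨ (σ 0 = 2 ∧ σ 1 = 0 ∧ σ 2 = 1) ∨
    (σ 0 = 1 ∧ σ 1 = 2 ∧ σ 2 = 0) ∨ (σ 0 = 2 ∧ σ 1 = 1 ∧ σ 2 = 0) := by decide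
  rcases this σ with h | h | h | h | h | h <;> obtain ⟨h0, h1, h2⟩ := h
  · left; funext p q r; simp [permSig, h0, h1, h2]
  · right; left; funext p q r; simp [permSig, h0, h1, h2]
  · right; right; left; funext p q r; simp [permSig, h0, h1, h2]
  · right; right; right; left; funext p q r; simp [permSig, h0, h1, h2]
  · right; right; right; right; left; funext p q r; simp [permSig, h0, h1, h2]
  · right; right; right; right; right; funext p q r; simp [permSig, h0, h1, h2]

lemma HH_132 (f : Bool → Bool → Bool → ℂ) (i j k : Bool) :
    HH (fun p q r => f p r q) i j k = HH f i k j := by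
  simp only [HH, hat2, Fintype.sum_bool]; ring
lemma HH_213 (f : Bool → Bool → Bool → ℂ) (i j k : Bool) :
    HH (fun p q r => f q p r) i j k = HH f j i k := by
  simp only [HH, hat2, Fintype.sum_bool]; ring
lemma HH_a (f : Bool → Bool → Bool → ℂ) (i j k : Bool) :
    HH (fun p q r => f r p q) i j k = HH f k i j := by
  simp only [HH, hat2, Fintype.sum_bool]; ring
lemma HH_b (f : Bool → Bool → Bool → ℂ) (i j k : Bool) :
    HH (fun p q r => f q r p) i j k = HH f j k i := by
  simp only [HH, hat2, Fintype.sum_bool]; ring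
lemma HH_321 (f : Bool → Bool → Bool → ℂ) (i j k : Bool) :
    HH (fun p q r => f r q p) i j k = HH f k j i := by
  simp only [HH, hat2, Fintype.sum_bool]; ring

/-- Inverse of the transform in slots two and three. -/
lemma hat2_inj (A : Bool → Bool → ℂ) (h : ∀ j k, hat2 A j k = 0) (b c : Bool) : A b c = 0 := by
  have h1 := h false false
  have h2 := h false true
  have h3 := h true false
  have h4 := h true true
  simp only [hat2, zz, Fintype.sum_bool, cond_true, cond_false] at h1 h2 h3 h4
  have hI := I2
  cases b <;> cases c
  · linear_combination (h1 + h2 + h3 + h4) / 4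
  · linear_combination (h1 - h2 + h3 - h4) / 4 * (-Complex.I) + hI * A false true
  · linear_combination (h1 + h2 - h3 - h4) / 4 * (-Complex.I) + hI * A true false
  · linear_combination -(h1 - h2 - h3 + h4) / 4 + hI * A true true

lemma slot1 (g : Bool → Bool → Bool → ℂ) (i : Bool) (h : ∀ j k, HH g i j k = 0) (p q r : Bool) :
    g p q r = zz i p * g false q r := by
  have := hat2_inj (fun b c => g false b c + zz i true * g true b c) (fun j k => by
    rw [← h j k, HH_eq]; simp only [hat2, Fintype.sum_bool]; ring) q r
  have hI := I2
  cases p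
  · simp [zz]
  · cases i <;> simp only [zz, cond_true, cond_false] at this ⊢
    · linear_combination -Complex.I * this + hI * g true q r
    · linear_combination Complex.I * this + hI * g true q r

lemma notdup (f : Bool → Bool → Bool → ℂ) (hdup : ¬ InDUP f) (i : Bool) :
    (¬ ∀ j k, HH f i j k = 0) ∧ (¬ ∀ j k, HH f j i k = 0) ∧ (¬ ∀ j k, HH f j k i = 0) := by
  refine ⟨fun h => hdup ?_, fun h => hdup ?_, fun h => hdup ?_⟩
  · exact ⟨1, zz i, f false, fun p q r => by simpa [permSig] using slot1 f i h p q r⟩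
  · refine ⟨Equiv.swap 0 1, zz i, fun q r => f q false r, fun p q r => ?_⟩
    have := slot1 (fun p q r => f q p r) i (fun j k => by rw [HH_213]; exact h j k) p q r
    have e2 : (Equiv.swap (0 : Fin 3) 1) 2 = 2 := by decide
    simpa [permSig, e2] using this
  · refine ⟨Equiv.swap 0 2, zz i, fun q r => f r q false, fun p q r => ?_⟩
    have := slot1 (fun p q r => f r q p) i (fun j k => by rw [HH_321]; exact h k j) p q r
    have e2 : (Equiv.swap (0 : Fin 3) 2) 1 = 1 := by decide
    simpa [permSig, e2] using this

/-- Triangle contraction of three matrices in the hat basis. -/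
lemma tri (A B C : Bool → Bool → ℂ) :
    8 * ∑ p : Bool, ∑ q : Bool, ∑ r : Bool, A p r * B q p * C r q =
    ∑ p : Bool, ∑ q : Bool, ∑ r : Bool, hat2 A p r * hat2 B q (!p) * hat2 C (!r) (!q) := by
  have con : ∀ v w : Bool → ℂ, ∑ x : Bool, v x * w x =
      (1/2) * ∑ s : Bool, (∑ x : Bool, zz s x * v x) * (∑ x : Bool, zz (!s) x * w x) := by
    intro v w
    simp only [zz, Fintype.sum_bool, cond_true, cond_false, Bool.not_true, Bool.not_false]
    linear_combination v true * w true * I2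
  have hI : Complex.I ^ 2 = -1 := Complex.I_sq
  have h3 : Complex.I ^ 3 = -Complex.I := by rw [pow_succ, hI]; ring
  have h4 : Complex.I ^ 4 = 1 := Complex.I_pow_four
  have h5 : Complex.I ^ 5 = Complex.I := by rw [pow_succ, h4]; ring
  have h6 : Complex.I ^ 6 = -1 := by rw [pow_succ, h5, I2]
  simp only [hat2, zz, Fintype.sum_bool, cond_true, cond_false, Bool.not_true, Bool.not_false]
  ring_nf
  simp only [hI, h4, h6]
  ring

lemma sym_hat (f : Bool → Bool → Bool → ℂ) (i j k : Bool) :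
    ∑ p : Bool, ∑ q : Bool, ∑ r : Bool, HH f i p r * HH f j q (!p) * HH f k (!r) (!q) =
    8 * ∑ x : Bool, ∑ y : Bool, ∑ z : Bool, zz i x * zz j y * zz k z * SymSig f x y z := by
  have e : ∀ i, (fun p q => HH f i p q) = hat2 (fun b c => f false b c + zz i true * f true b c) := by
    intro i; funext p q; rw [HH_eq]; simp only [hat2, Fintype.sum_bool]; ring
  have e' : ∀ i p q, HH f i p q = hat2 (fun b c => f false b c + zz i true * f true b c) p q :=
    fun i p q => congrFun (congrFun (e i) p) q
  simp only [e']
  rw [← tri]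
  have z0 : ∀ i, zz i false = 1 := fun i => rfl
  simp only [SymSig, Fintype.sum_bool, z0]
  ring

lemma legal_hat (f : Bool → Bool → Bool → ℂ) (hleg : SIG1Legal f) :
    let S := fun i j k => ∑ p : Bool, ∑ q : Bool, ∑ r : Bool,
      HH f i p r * HH f j q (!p) * HH f k (!r) (!q)
    S false false false ≠ 0 ∧ S true true true ≠ 0 ∧ S false false true = 0
      ∧ S false true true = 0 := by
  obtain ⟨a, b, hab, h⟩ := hleg
  intro S
  have hI : Complex.I ^ 2 = -1 := Complex.I_sq
  have k1 : S false false false = 32 * (a + Complex.I * b) := by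
    simp only [S]; rw [sym_hat]; simp only [h, Fintype.sum_bool, wt, zz, cond_true, cond_false]; norm_num
    try (ring_nf; (try simp only [hI, Complex.I_pow_three]); (try ring))
  have k2 : S true true true = 32 * (a - Complex.I * b) := by
    simp only [S]; rw [sym_hat]; simp only [h, Fintype.sum_bool, wt, zz, cond_true, cond_false]; norm_num
    try (ring_nf; (try simp only [hI, Complex.I_pow_three]); (try ring))
  have k3 : S false false true = 0 := by
    simp only [S]; rw [sym_hat]; simp only [h, Fintype.sum_bool, wt, zz, cond_true, cond_false]; norm_num
    try (ring_nf; (try simp only [hI, Complex.I_pow_three]); (try ring))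
  have k4 : S false true true = 0 := by
    simp only [S]; rw [sym_hat]; simp only [h, Fintype.sum_bool, wt, zz, cond_true, cond_false]; norm_num
    try (ring_nf; (try simp only [hI, Complex.I_pow_three]); (try ring))
  refine ⟨fun h0 => hab ?_, fun h0 => hab ?_, k3, k4⟩
  · rw [k1] at h0
    linear_combination (a - Complex.I * b) / 32 * h0 + b ^ 2 * hI
  · rw [k2] at h0
    linear_combination (a + Complex.I * b) / 32 * h0 + b ^ 2 * hI

lemma E_type (H : Bool → Bool → Bool → ℂ)
    (h : ∀ j, (∀ i, H i j false = 0) ∨ (∀ i, H i j true = 0))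
    (n : ∀ i, ¬ ∀ j k, H j k i = 0) :
    ((∀ i, H i false true = 0) ∧ (∀ i, H i true false = 0)) ∨
    ((∀ i, H i false false = 0) ∧ (∀ i, H i true true = 0)) := by
  rcases h false with a | a <;> rcases h true with b | b
  · exact absurd (fun j k => by cases k <;> simp [a, b]) (n false)
  · exact Or.inr ⟨a, b⟩
  · exact Or.inl ⟨a, b⟩
  · exact absurd (fun j k => by cases k <;> simp [a, b]) (n true)

/-- Type of the even condition with the unary in the first slot. -/
def EE (H : Bool → Bool → Bool → ℂ) : Prop :=
  ((∀ i, H i false true = 0) ∧ (∀ i, H i true false = 0)) ∨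
    ((∀ i, H i false false = 0) ∧ (∀ i, H i true true = 0))

def TT (H : Bool → Bool → Bool → ℂ) : Prop :=
  (∀ i, H i false false * H i true true + H i false true * H i true false = 0) ∧
    (H false false false * H true true true + H false false true * H true true false
     + H true false false * H false true true
       + H true false true * H false true false = 0)

lemma E_slots (f : Bool → Bool → Bool → ℂ) (hdup : ¬ InDUP f) (σ : Equiv.Perm (Fin 3))
    (h : {ε : ℂ | ¬ (SymLSig (permSig f σ) ε false false = SymLSig (permSig f σ) ε true true ∧
        SymLSig (permSig f σ) ε false true = 0)}.Finite) :
    EE (HH f) ∨ EE (fun i j k => HH f j i k) ∨ EE (fun i j k => HH f j k i) := by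
  have hE := E_hat _ h
  have n1 := fun i => (notdup f hdup i).1
  have n2 := fun i => (notdup f hdup i).2.1
  have n3 := fun i => (notdup f hdup i).2.2
  rcases perm_cases f σ with e | e | e | e | e | e <;> rw [e] at hE
  · left; exact E_type _ hE n3
  · left; simp only [HH_132] at hE
    have := E_type (fun i j k => HH f i k j) hE (fun i hh => n2 i fun j k => hh j k)
    unfold EE; tauto
  · right; left; simp only [HH_213] at hE
    exact E_type (fun i j k => HH f j i k) hE (fun i hh => n3 i fun j k => hh k j)
  · right; left; simp only [HH_a] at hE
    have := E_type (fun i j k => HH f k i j) hE (fun i hh => n1 i fun j k => hh j k)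
    unfold EE; tauto
  · right; right; simp only [HH_b] at hE
    exact E_type (fun i j k => HH f j k i) hE (fun i hh => n2 i fun j k => hh k j)
  · right; right; simp only [HH_321] at hE
    have := E_type (fun i j k => HH f k j i) hE (fun i hh => n1 i fun j k => hh k j)
    unfold EE; tauto

lemma T_swap (H : Bool → Bool → Bool → ℂ) (h : TT (fun i j k => H i k j)) : TT H := by
  obtain ⟨h1, h2⟩ := h
  refine ⟨fun i => ?_, ?_⟩
  · linear_combination h1 i
  · linear_combination h2

lemma T_slots (f : Bool → Bool → Bool → ℂ) (σ : Equiv.Perm (Fin 3))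
    (h : {ε : ℂ | SymLSig (permSig f σ) ε false false + SymLSig (permSig f σ) ε true true
        ≠ 0}.Finite) :
    TT (HH f) ∨ TT (fun i j k => HH f j i k) ∨ TT (fun i j k => HH f j k i) := by
  have hT := T_hat _ h
  rcases perm_cases f σ with e | e | e | e | e | e <;> rw [e] at hT
  · left; exact hT
  · left; simp only [HH_132] at hT
    exact T_swap _ hT
  · right; left; simp only [HH_213] at hT
    exact hT
  · right; left; simp only [HH_a] at hT
    exact T_swap _ hT
  · right; right; simp only [HH_b] at hT
    exact hT
  · right; right; simp only [HH_321] at hT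
    exact T_swap _ hT

/-- Same slot: the two conditions together force a degenerate signature. -/
lemma same_slot (H : Bool → Bool → Bool → ℂ) (n2 : ∀ i, ¬ ∀ j k, H j i k = 0)
    (hE : EE H) (hT : TT H) : False := by
  obtain ⟨h1, h2⟩ := hT
  have a := h1 false
  have b := h1 true
  rcases hE with ⟨p, q⟩ | ⟨p, q⟩
  · simp only [p, q, mul_zero, zero_mul, add_zero, zero_add] at a b h2
    have : (∀ i, H i false false = 0) ∨ (∀ i, H i true true = 0) := by
      simp only [Bool.forall_bool]; grind
    rcases this with t | t
    · exact n2 false fun j k => by cases k <;> simp [t, p]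
    · exact n2 true fun j k => by cases k <;> simp [t, q]
  · simp only [p, q, mul_zero, zero_mul, add_zero, zero_add] at a b h2
    have : (∀ i, H i false true = 0) ∨ (∀ i, H i true false = 0) := by
      simp only [Bool.forall_bool]; grind
    rcases this with t | t
    · exact n2 false fun j k => by cases k <;> simp [t, p]
    · exact n2 true fun j k => by cases k <;> simp [t, q]

lemma cubes (v v' w w' : ℂ) (h1 : v ^ 3 + w ^ 3 ≠ 0) (h2 : v' ^ 3 + w' ^ 3 ≠ 0)
    (h3 : v ^ 2 * v' + w ^ 2 * w' = 0) (h4 : v * v' ^ 2 + w * w' ^ 2 = 0)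
    (h5 : v * w' + v' * w = 0) : False := by
  have d1 : v * v' * (v * w') = 0 := by
    linear_combination (w' * h3 - w * h4 + v * v' * h5) / 2
  have d2 : w * w' * (v * w') = 0 := by
    linear_combination (-v' * h3 + v * h4 + w * w' * h5) / 2
  simp only [mul_eq_zero] at d1 d2
  rcases d1 with (d | d) | (d | d) <;> rcases d2 with (e | e) | (e | e) <;> simp_all

/-- The triangle contraction in the hat basis. -/
noncomputable def SS (H : Bool → Bool → Bool → ℂ) (i j k : Bool) : ℂ :=
  ∑ p : Bool, ∑ q : Bool, ∑ r : Bool, H i p r * H j q (!p) * H k (!r) (!q)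

lemma slot1_final (H : Bool → Bool → Bool → ℂ) (s1 : SS H false false false ≠ 0)
    (s2 : SS H true true true ≠ 0) (s3 : SS H false false true = 0) (s4 : SS H false true true = 0)
    (hE : EE H)
    (hP : H false false false * H true true true + H false false true * H true true false
      + H false true false * H true false true + H false true true * H true false false = 0) :
    False := by
  simp only [SS, Fintype.sum_bool, Bool.not_true, Bool.not_false] at s1 s2 s3 s4
  rcases hE with ⟨p, q⟩ | ⟨p, q⟩ <;>
    simp only [p, q, mul_zero, zero_mul, add_zero, zero_add, ne_eq, not_true] at s1 s2 s3 s4 hP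
  exact cubes (H false false true) (H true false true) (H false true false) (H true true false)
    (fun h => s1 (by linear_combination h)) (fun h => s2 (by linear_combination h))
    (by linear_combination s3) (by linear_combination s4) (by linear_combination hP)

lemma slot2_final (H : Bool → Bool → Bool → ℂ) (s1 : SS H false false false ≠ 0)
    (s2 : SS H true true true ≠ 0) (s3 : SS H false false true = 0) (s4 : SS H false true true = 0)
    (hE : EE (fun i j k => H j i k))
    (hP : H false false false * H true true true + H false false true * H true true false
      + H false true false * H true false true + H false true true * H true false false = 0) :
    False := by
  simp only [SS, Fintype.sum_bool, Bool.not_true, Bool.not_false] at s1 s2 s3 s4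
  rcases hE with ⟨p, q⟩ | ⟨p, q⟩ <;>
    simp only [p, q, mul_zero, zero_mul, add_zero, zero_add, ne_eq, not_true] at s1 s2 s3 s4 hP
  all_goals
    simp only [mul_eq_zero, not_or] at s1 s2 s3 s4
    simp_all
    rcases s3 with t | t <;> simp_all

lemma slot3_final (H : Bool → Bool → Bool → ℂ) (s1 : SS H false false false ≠ 0)
    (s2 : SS H true true true ≠ 0) (s3 : SS H false false true = 0) (s4 : SS H false true true = 0)
    (hE : EE (fun i j k => H j k i))
    (hP : H false false false * H true true true + H false false true * H true true false
      + H false true false * H true false true + H false true true * H true false false = 0) :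
    False := by
  simp only [SS, Fintype.sum_bool, Bool.not_true, Bool.not_false] at s1 s2 s3 s4
  rcases hE with ⟨p, q⟩ | ⟨p, q⟩ <;>
    simp only [p, q, mul_zero, zero_mul, add_zero, zero_add, ne_eq, not_true] at s1 s2 s3 s4 hP
  all_goals
    simp only [mul_eq_zero, not_or] at s1 s2 s3 s4
    simp_all
    rcases s3 with t | t <;> simp_all

/-- If `f` is `SIG₁`-legal, `f ∉ DUP`, and for every permutation `σ` and all but finitely
many `ε` either `g₀ + g₂ = 0` or (`g₀ = g₂` and `g₁ = 0`) holds for `SymLSig(f_σ)_ε`, then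
there are no two distinct permutations `σ, τ` such that (`g₀ = g₂` and `g₁ = 0`) holds
for `σ` for all but finitely many `ε` and `g₀ + g₂ = 0` holds for `τ` for all but
finitely many `ε`. -/
theorem no_mixed_permutations (f : Bool → Bool → Bool → ℂ)
    (hleg : SIG1Legal f) (hdup : ¬ InDUP f)
    (hstar : ∀ σ : Equiv.Perm (Fin 3),
      {ε : ℂ | ¬ (SymLSig (permSig f σ) ε false false + SymLSig (permSig f σ) ε true true = 0 ∨
        (SymLSig (permSig f σ) ε false false = SymLSig (permSig f σ) ε true true ∧
          SymLSig (permSig f σ) ε false true = 0))}.Finite) :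
    ¬ ∃ σ τ : Equiv.Perm (Fin 3), σ ≠ τ ∧
      {ε : ℂ | ¬ (SymLSig (permSig f σ) ε false false = SymLSig (permSig f σ) ε true true ∧
        SymLSig (permSig f σ) ε false true = 0)}.Finite ∧
      {ε : ℂ | SymLSig (permSig f τ) ε false false + SymLSig (permSig f τ) ε true true
        ≠ 0}.Finite := by
  rintro ⟨σ, τ, -, hσ, hτ⟩
  have n1 := fun i => (notdup f hdup i).1
  have n2 := fun i => (notdup f hdup i).2.1
  obtain ⟨s1, s2, s3, s4⟩ := legal_hat f hleg
  change SS (HH f) _ _ _ ≠ 0 at s1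
  change SS (HH f) _ _ _ ≠ 0 at s2
  change SS (HH f) _ _ _ = 0 at s3
  change SS (HH f) _ _ _ = 0 at s4
  have hE := E_slots f hdup σ hσ
  have hT := T_slots f τ hτ
  clear hleg hdup hstar hσ hτ
  generalize HH f = H at *
  rcases hE with hE | hE | hE <;> rcases hT with hT | hT | hT
  · exact same_slot _ n2 hE hT
  · exact slot1_final H s1 s2 s3 s4 hE (by have := hT.2; linear_combination this)
  · exact slot1_final H s1 s2 s3 s4 hE (by have := hT.2; linear_combination this)
  · exact slot2_final H s1 s2 s3 s4 hE (by have := hT.2; linear_combination this)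
  · exact same_slot (fun i j k => H j i k) (fun i hh => n1 i fun j k => hh j k) hE hT
  · exact slot2_final H s1 s2 s3 s4 hE (by have := hT.2; linear_combination this)
  · exact slot3_final H s1 s2 s3 s4 hE (by have := hT.2; linear_combination this)
  · exact slot3_final H s1 s2 s3 s4 hE (by have := hT.2; linear_combination this)
  · exact same_slot (fun i j k => H j k i) (fun i hh => n1 i fun j k => hh k j) hE hT
end

section
/- Let f be a ternary signature identified with the tuple (a,b,c,d,x,y,z,w), and for ε ∈ ℂ write SymL(f)_ε = [g₀,ε, g₁,ε, g₂,ε]. If g₀,ε + g₂,ε = 0 holds for at least three distinct values of ε ∈ ℂ, then x²+y²+z²+w² = 0, a²+b²+c²+d² = 0, and ax+by+cz+dw = 0. -/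
open Finset

/-- If `g₀ + g₂ = 0` holds for `SymLSig(f)_ε` for at least three distinct values of `ε`,
then `x²+y²+z²+w² = 0`, `a²+b²+c²+d² = 0`, and `ax+by+cz+dw = 0`. -/
theorem three_eps_sum_zero (f : Bool → Bool → Bool → ℂ) (a b c d x y z w : ℂ)
    (h000 : f false false false = a) (h001 : f false false true = b)
    (h010 : f false true false = c) (h011 : f false true true = d)
    (h100 : f true false false = x) (h101 : f true false true = y)
    (h110 : f true true false = z) (h111 : f true true true = w)
    (hε : ∃ ε₁ ε₂ ε₃ : ℂ, ε₁ ≠ ε₂ ∧ ε₁ ≠ ε₃ ∧ ε₂ ≠ ε₃ ∧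
      ∀ ε ∈ ({ε₁, ε₂, ε₃} : Set ℂ),
        SymLSig f ε false false + SymLSig f ε true true = 0) :
    x ^ 2 + y ^ 2 + z ^ 2 + w ^ 2 = 0 ∧
    a ^ 2 + b ^ 2 + c ^ 2 + d ^ 2 = 0 ∧
    a * x + b * y + c * z + d * w = 0 := by
  obtain ⟨e₁, e₂, e₃, h12, h13, h23, h⟩ := hε
  have key : ∀ e ∈ ({e₁, e₂, e₃} : Set ℂ),
      (x ^ 2 + y ^ 2 + z ^ 2 + w ^ 2) * e ^ 2 + 2 * (a * x + b * y + c * z + d * w) * e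
        + (a ^ 2 + b ^ 2 + c ^ 2 + d ^ 2) = 0 := by
    intro e he
    have := h e he
    simp only [SymLSig, Fintype.sum_bool, h000, h001, h010, h011, h100, h101, h110, h111,
      cond_true, cond_false] at this
    linear_combination this
  have k1 := key e₁ (by simp)
  have k2 := key e₂ (by simp)
  have k3 := key e₃ (by simp)
  generalize x ^ 2 + y ^ 2 + z ^ 2 + w ^ 2 = A at *
  generalize a ^ 2 + b ^ 2 + c ^ 2 + d ^ 2 = C at *
  generalize a * x + b * y + c * z + d * w = B at *
  have l1 : A * (e₁ + e₂) + 2 * B = 0 :=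
    mul_left_cancel₀ (sub_ne_zero.2 h12) (by linear_combination k1 - k2)
  have l2 : A * (e₁ + e₃) + 2 * B = 0 :=
    mul_left_cancel₀ (sub_ne_zero.2 h13) (by linear_combination k1 - k3)
  have hA : A = 0 :=
    mul_left_cancel₀ (sub_ne_zero.2 h23) (by linear_combination l1 - l2)
  subst hA
  have hB : B = 0 := by linear_combination l1 / 2
  subst hB
  exact ⟨rfl, by linear_combination k1, rfl⟩
end

section
/- Let f be a ternary signature identified with the tuple (a,b,c,d,x,y,z,w), and for ε ∈ ℂ write SymL(f)_ε = [g₀,ε, g₁,ε, g₂,ε]. If g₀,ε · g₂,ε = (g₁,ε)² holds for at least five distinct values of ε ∈ ℂ, then ad = bc, xw = yz, and aw + dx = bz + cy. -/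
open Finset

/-- If `g₀ · g₂ = g₁²` holds for `SymLSig(f)_ε` for at least five distinct values of `ε`,
then `ad = bc`, `xw = yz`, and `aw + dx = bz + cy`. -/
theorem five_eps_degenerate (f : Bool → Bool → Bool → ℂ) (a b c d x y z w : ℂ)
    (h000 : f false false false = a) (h001 : f false false true = b)
    (h010 : f false true false = c) (h011 : f false true true = d)
    (h100 : f true false false = x) (h101 : f true false true = y)
    (h110 : f true true false = z) (h111 : f true true true = w)
    (hε : ∃ S : Finset ℂ, 5 ≤ S.card ∧ ∀ ε ∈ S,
      SymLSig f ε false false * SymLSig f ε true true = (SymLSig f ε false true) ^ 2) :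
    a * d = b * c ∧ x * w = y * z ∧ a * w + d * x = b * z + c * y := by
  obtain ⟨S, hS, h⟩ := hε
  have key : ∀ ε ∈ S, (a * d - b * c) + (a * w + d * x - b * z - c * y) * ε
      + (x * w - y * z) * ε ^ 2 = 0 := by
    intro ε hε
    have h1 := h ε hε
    simp only [SymLSig, Fintype.sum_bool, cond_true, cond_false, h000, h001, h010, h011,
      h100, h101, h110, h111] at h1
    have h2 : ((a * d - b * c) + (a * w + d * x - b * z - c * y) * ε
      + (x * w - y * z) * ε ^ 2) ^ 2 = 0 := by linear_combination h1
    exact pow_eq_zero_iff (two_ne_zero) |>.mp h2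
  have h3 : 2 < S.card := by omega
  obtain ⟨r, s, t, hr, hs, ht, hrs, hrt, hst⟩ := Finset.two_lt_card_iff.mp h3
  have kr := key r hr
  have ks := key s hs
  have kt := key t ht
  generalize hA : a * d - b * c = A at kr ks kt
  generalize hB : a * w + d * x - b * z - c * y = B at kr ks kt
  generalize hC : x * w - y * z = C at kr ks kt
  have e1 : B + C * (r + s) = 0 :=
    mul_left_cancel₀ (sub_ne_zero.mpr hrs) (by linear_combination kr - ks)
  have e2 : B + C * (r + t) = 0 :=
    mul_left_cancel₀ (sub_ne_zero.mpr hrt) (by linear_combination kr - kt)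
  have hC0 : C = 0 :=
    mul_left_cancel₀ (sub_ne_zero.mpr hst) (by linear_combination e1 - e2)
  have hB0 : B = 0 := by linear_combination e1 - (r + s) * hC0
  have hA0 : A = 0 := by linear_combination kr - r * hB0 - r ^ 2 * hC0
  refine ⟨?_, ?_, ?_⟩
  · linear_combination hA + hA0
  · linear_combination hC + hC0
  · linear_combination hB + hB0
end

section
/- Let f be a ternary signature identified with the tuple (a,b,c,d,x,y,z,w). If ad = bc, xw = yz, and aw + dx = bz + cy, then f ∈ DUP. -/
open Finset

theorem rank_one_aux_s16 (a b c d : ℂ) (h : a * d = b * c) :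
    ∃ p₀ p₁ q₀ q₁ : ℂ, a = p₀ * q₀ ∧ b = p₀ * q₁ ∧ c = p₁ * q₀ ∧ d = p₁ * q₁ := by
  by_cases ha : a = 0
  · subst ha
    have h' : b = 0 ∨ c = 0 := by simpa [eq_comm] using h
    rcases h' with rfl | rfl
    · exact ⟨0, 1, c, d, by simp⟩
    · exact ⟨b, d, 0, 1, by simp⟩
  · refine ⟨1, c / a, a, b, by simp, by simp, by field_simp, ?_⟩
    field_simp
    linear_combination h

/-- If the tuple `(a,b,c,d,x,y,z,w)` of values of `f` satisfies `ad = bc`, `xw = yz`,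
and `aw + dx = bz + cy`, then `f ∈ DUP`. -/
theorem dup_criterion_first (f : Bool → Bool → Bool → ℂ) (a b c d x y z w : ℂ)
    (h000 : f false false false = a) (h001 : f false false true = b)
    (h010 : f false true false = c) (h011 : f false true true = d)
    (h100 : f true false false = x) (h101 : f true false true = y)
    (h110 : f true true false = z) (h111 : f true true true = w)
    (e1 : a * d = b * c) (e2 : x * w = y * z)
    (e3 : a * w + d * x = b * z + c * y) :
    InDUP f := by
  obtain ⟨p₀, p₁, q₀, q₁, rfl, rfl, rfl, rfl⟩ := rank_one_aux_s16 a b c d e1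
  obtain ⟨r₀, r₁, s₀, s₁, rfl, rfl, rfl, rfl⟩ := rank_one_aux_s16 x y z w e2
  have h : (p₀ * r₁ - p₁ * r₀) * (q₀ * s₁ - q₁ * s₀) = 0 := by linear_combination e3
  rcases mul_eq_zero.mp h with h | h
  · obtain ⟨α, β, t₀, t₁, rfl, rfl, rfl, rfl⟩ := rank_one_aux_s16 p₀ p₁ r₀ r₁ (sub_eq_zero.mp h)
    refine ⟨Equiv.swap 0 1, fun i => cond i t₁ t₀,
      fun i j => cond i (β * cond j s₁ s₀) (α * cond j q₁ q₀), ?_⟩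
    have h0 : (Equiv.swap (0 : Fin 3) 1) 0 = 1 := by decide
    have h1 : (Equiv.swap (0 : Fin 3) 1) 1 = 0 := by decide
    have h2 : (Equiv.swap (0 : Fin 3) 1) 2 = 2 := by decide
    intro i j k
    rw [permSig, h0, h1, h2]
    cases i <;> cases j <;> cases k <;> simp [h000, h001, h010, h011, h100, h101, h110, h111] <;> ring
  · obtain ⟨α, β, t₀, t₁, rfl, rfl, rfl, rfl⟩ := rank_one_aux_s16 q₀ q₁ s₀ s₁ (sub_eq_zero.mp h)
    refine ⟨Equiv.swap 0 2, fun i => cond i t₁ t₀,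
      fun j i => cond i (β * cond j r₁ r₀) (α * cond j p₁ p₀), ?_⟩
    have h0 : (Equiv.swap (0 : Fin 3) 2) 0 = 2 := by decide
    have h1 : (Equiv.swap (0 : Fin 3) 2) 1 = 1 := by decide
    have h2 : (Equiv.swap (0 : Fin 3) 2) 2 = 0 := by decide
    intro i j k
    rw [permSig, h0, h1, h2]
    cases i <;> cases j <;> cases k <;> simp [h000, h001, h010, h011, h100, h101, h110, h111] <;> ring
end

section
/- Let f be a ternary signature identified with the tuple (a,b,c,d,x,y,z,w). If ay = bx, cw = dz, and aw + cy = bz + dx, then f ∈ DUP. -/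
open Finset

theorem par_aux {ι : Type} (g h : ι → ℂ) (H : ∀ i j, g i * h j = g j * h i) :
    ∃ (u0 u1 : ℂ) (k : ι → ℂ), (∀ i, g i = u0 * k i) ∧ (∀ i, h i = u1 * k i) := by
  by_cases hg : ∀ i, g i = 0
  · exact ⟨0, 1, h, fun i => by simp [hg i], fun i => by simp⟩
  · push Not at hg
    obtain ⟨i, hi⟩ := hg
    refine ⟨1, h i / g i, g, fun j => by simp, fun j => ?_⟩
    field_simp
    linear_combination H i j

theorem par_two (a b x y : ℂ) (e : a * y = b * x) :
    ∃ p q r s : ℂ, a = p * r ∧ b = p * s ∧ x = q * r ∧ y = q * s := by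
  obtain ⟨p, q, k, h1, h2⟩ := par_aux (fun i : Bool => cond i b a) (fun i => cond i y x) (by
    rintro (_ | _) (_ | _) <;> simp [e])
  exact ⟨p, q, k false, k true, h1 false, h1 true, h2 false, h2 true⟩

/-- If the tuple `(a,b,c,d,x,y,z,w)` of values of `f` satisfies `ay = bx`, `cw = dz`,
and `aw + cy = bz + dx`, then `f ∈ DUP`. -/
theorem dup_criterion_second (f : Bool → Bool → Bool → ℂ) (a b c d x y z w : ℂ)
    (h000 : f false false false = a) (h001 : f false false true = b)
    (h010 : f false true false = c) (h011 : f false true true = d)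
    (h100 : f true false false = x) (h101 : f true false true = y)
    (h110 : f true true false = z) (h111 : f true true true = w)
    (e1 : a * y = b * x) (e2 : c * w = d * z)
    (e3 : a * w + c * y = b * z + d * x) :
    InDUP f := by
  obtain ⟨p, q, r, s, rfl, rfl, rfl, rfl⟩ := par_two a b x y e1
  obtain ⟨P, Q, R, S, rfl, rfl, rfl, rfl⟩ := par_two c d z w e2
  have h : (p * Q - q * P) * (r * S - s * R) = 0 := by linear_combination e3
  rcases mul_eq_zero.mp h with h | h
  · obtain ⟨u0, u1, k, h1, h2⟩ := par_aux (fun i : Bool × Bool => f false i.1 i.2)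
      (fun i => f true i.1 i.2) (by
        rintro ⟨_ | _, i⟩ ⟨_ | _, j⟩ <;> cases i <;> cases j <;>
          simp only [h000, h001, h010, h011, h100, h101, h110, h111] <;> grind)
    refine ⟨1, fun i => cond i u1 u0, fun i j => k (i, j), ?_⟩
    rintro (_ | _) i j
    · exact h1 (i, j)
    · exact h2 (i, j)
  · obtain ⟨u0, u1, k, h1, h2⟩ := par_aux (fun i : Bool × Bool => f i.2 i.1 false)
      (fun i => f i.2 i.1 true) (by
        rintro ⟨_ | _, i⟩ ⟨_ | _, j⟩ <;> cases i <;> cases j <;>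
          simp only [h000, h001, h010, h011, h100, h101, h110, h111] <;> grind)
    refine ⟨Equiv.swap 0 2, fun i => cond i u1 u0, fun i j => k (i, j), ?_⟩
    have e : ∀ p q r, permSig f (Equiv.swap 0 2) p q r = f r q p := fun p q r => rfl
    rintro (_ | _) i j
    · exact (e _ _ _).trans (h1 (i, j))
    · exact (e _ _ _).trans (h2 (i, j))
end
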